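/- Let L be a bounded linear operator on a complex Banach space 𝔅, let h₀ ∈ 𝔅 and Λ > 0, and let (ℓ_k)_{k≥1} be continuous linear functionals on 𝔅 satisfying: (B1) limsup_{k→∞} ‖ℓ_k‖^{1/k} ≤ Λ^{-1}; (B2) ℓ₁(h₀) = 1 and ℓ_{k+1}(h₀) = 0 for all k ≥ 1; (B3) ℓ_{k+1}(L h) = ℓ_k(h) for all k ≥ 1 and all h ∈ 𝔅. Define the rank-one operator K : 𝔅 → 𝔅 by K h = ℓ₁(L h)·h₀. Then for every λ ∈ ℂ with |λ| < Λ and every h ∈ 𝔅, the functional Ξ_λ := Σ_{k=1}^∞ λ^k ℓ_k satisfies Ξ_λ((L − K) h) = λ·Ξ_λ(h); that is, Ξ_λ is an eigenvector of the adjoint of L − K with eigenvalue λ. -/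

import Mathlib

open Filter

/-- With (B1), (B2), (B3) and the rank-one operator
`K h = ℓ 1 (L h) • h₀`, for every `z : ℂ` with `‖z‖ < Λ` and every `h`, the functional
`Ξ_z = ∑_{k=1}^∞ z^k • ℓ k` satisfies `Ξ_z ((L - K) h) = z • Ξ_z h`; that is, `Ξ_z`
is an eigenvector of the adjoint of `L - K` with eigenvalue `z`. -/
theorem stmt3
    {B : Type*} [NormedAddCommGroup B] [NormedSpace ℂ B] [CompleteSpace B]
    (L : B →L[ℂ] B) (ℓ : ℕ → (B →L[ℂ] ℂ)) (Λ : ℝ) (hΛ : 0 < Λ) (h₀ : B)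
    (hB1 : Filter.limsup (fun k : ℕ => ‖ℓ k‖ ^ ((k : ℝ)⁻¹)) Filter.atTop ≤ Λ⁻¹)
    (hB2a : ℓ 1 h₀ = 1) (hB2b : ∀ k : ℕ, 1 ≤ k → ℓ (k + 1) h₀ = 0)
    (hB3 : ∀ k : ℕ, 1 ≤ k → ∀ h : B, ℓ (k + 1) (L h) = ℓ k h)
    (K : B → B) (hK : ∀ h : B, K h = ℓ 1 (L h) • h₀) :
    ∀ z : ℂ, ‖z‖ < Λ → ∀ h : B,
      (∑' k : ℕ, z ^ (k + 1) • ℓ (k + 1)) (L h - K h) =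
        z * (∑' k : ℕ, z ^ (k + 1) • ℓ (k + 1)) h := by
  intro z hz h
  by_cases hs : Summable fun k : ℕ => z ^ (k + 1) • ℓ (k + 1)
  · have hev (g : B) : HasSum (fun k : ℕ => z ^ (k + 1) * ℓ (k + 1) g)
        ((∑' k : ℕ, z ^ (k + 1) • ℓ (k + 1)) g) := by
      simpa using hs.hasSum.mapL (ContinuousLinearMap.apply ℂ ℂ g)
    refine (hev (L h - K h)).unique ?_
    rw [← hasSum_nat_add_iff' 1]
    have hzero : ∑ k ∈ Finset.range 1, z ^ (k + 1) * ℓ (k + 1) (L h - K h) = 0 := by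
      simp [hK, hB2a]
    rw [hzero, sub_zero]
    refine ((hev h).mul_left z).congr_fun ?_
    intro k
    rw [hK, map_sub, map_smul, hB2b (k + 1) (by omega), hB3 (k + 1) (by omega), smul_zero,
      sub_zero]
    ring
  · simp [tsum_eq_zero_of_not_summable hs]
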